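/- For every even integer d ≥ 4 and all real numbers c ≥ 0 and ε > 0, there exists N such that the following holds: every connected d-regular simple graph G on n ≥ N vertices with diam(G) ≥ 3n/(d+1) − c satisfies μ(G) ≥ (1−ε)·2(d−2)·π²/n². -/

import Mathlib

open Matrix Finset Filter

/-- The Laplacian quadratic form `xᵀ L(G) x`. -/
noncomputable def lapQ {V : Type*} [Fintype V] (G : SimpleGraph V) (x : V → ℝ) : ℝ :=
  letI := Classical.decEq V
  letI : DecidableRel G.Adj := Classical.decRel _
  x ⬝ᵥ (G.lapMatrix ℝ *ᵥ x)

/-- The Laplacian matrix of `G` over `ℝ` (classical decidability). -/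
noncomputable def lapMat {V : Type*} [Fintype V] (G : SimpleGraph V) : Matrix V V ℝ :=
  letI := Classical.decEq V
  letI : DecidableRel G.Adj := Classical.decRel _
  G.lapMatrix ℝ

/-- The algebraic connectivity `μ(G)`: the infimum of Rayleigh quotients of the Laplacian
over nonzero vectors orthogonal to the all-ones vector. -/
noncomputable def algConn {V : Type*} [Fintype V] (G : SimpleGraph V) : ℝ :=
  sInf {r : ℝ | ∃ x : V → ℝ, x ≠ 0 ∧ (∑ v, x v) = 0 ∧ r = lapQ G x / (∑ v, (x v) ^ 2)}

section OneDimensional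

/-- Young's inequality for the square of a sum. -/
lemma add_sq_le_weighted {δ : ℝ} (hδ : 0 < δ) (a b : ℝ) :
    (a + b) ^ 2 ≤ (1 + δ) * a ^ 2 + (1 + 1 / δ) * b ^ 2 := by
  have h : (1 + δ) * a ^ 2 + (1 + 1 / δ) * b ^ 2 - (a + b) ^ 2 = (δ * a - b) ^ 2 / δ := by
    field_simp
    ring
  have : 0 ≤ (δ * a - b) ^ 2 / δ := by positivity
  linarith

lemma ground_state_pointwise {a b p q : ℝ} (hp : 0 ≤ p) (hq : 0 ≤ q)
    (ha : p = 0 → a = 0) (hb : q = 0 → b = 0) :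
    (q - p) * (b ^ 2 / q - a ^ 2 / p) ≤ (b - a) ^ 2 := by
  rcases hp.eq_or_lt with rfl | hp
  · rcases hq.eq_or_lt with rfl | hq
    · simpa using sq_nonneg (b - a)
    · simp only [ha rfl]
      field_simp
      simp
  · rcases hq.eq_or_lt with rfl | hq
    · simp only [hb rfl]
      field_simp
      simp
    · have h : (b - a) ^ 2 - (q - p) * (b ^ 2 / q - a ^ 2 / p)
          = p * q * (b / q - a / p) ^ 2 := by
        field_simp
        ring
      have : 0 ≤ p * q * (b / q - a / p) ^ 2 := by positivity
      linarith

/-- The ground state inequality for a weighted path with Dirichlet boundary conditions. -/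
lemma ground_state_inequality (b : ℕ) (T φ M : ℕ → ℝ) (hT0 : T 0 = 0) (hTb : T (b + 1) = 0)
    (hM : ∀ k ≤ b, 0 < M k) (hφ0 : ∀ k ≤ b + 1, 0 ≤ φ k)
    (hφ : ∀ k ≤ b + 1, φ k = 0 → T k = 0) :
    ∑ k ∈ range b, ((φ (k + 1) - φ k) / M k - (φ (k + 2) - φ (k + 1)) / M (k + 1)) *
        (T (k + 1) ^ 2 / φ (k + 1)) ≤ ∑ k ∈ range (b + 1), (T (k + 1) - T k) ^ 2 / M k := by
  have parts : ∀ m : ℕ, ∑ k ∈ range (m + 1),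
        (φ (k + 1) - φ k) / M k * (T (k + 1) ^ 2 / φ (k + 1) - T k ^ 2 / φ k)
      = (φ (m + 1) - φ m) / M m * (T (m + 1) ^ 2 / φ (m + 1))
        + ∑ k ∈ range m, ((φ (k + 1) - φ k) / M k - (φ (k + 2) - φ (k + 1)) / M (k + 1)) *
        (T (k + 1) ^ 2 / φ (k + 1)) := by
    intro m
    induction m with
    | zero => simp [hT0]
    | succ m ih =>
      rw [sum_range_succ, ih, sum_range_succ _ m]
      ring
  have h1 := parts b
  simp only [hTb] at h1
  have h2 : ∑ k ∈ range (b + 1),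
        (φ (k + 1) - φ k) / M k * (T (k + 1) ^ 2 / φ (k + 1) - T k ^ 2 / φ k)
      ≤ ∑ k ∈ range (b + 1), (T (k + 1) - T k) ^ 2 / M k := by
    refine sum_le_sum fun k hk => ?_
    have hk := mem_range.1 hk
    have := ground_state_pointwise (hφ0 k (by omega)) (hφ0 (k + 1) (by omega)) (hφ k (by omega))
      (hφ (k + 1) (by omega))
    rw [div_mul_eq_mul_div]
    exact div_le_div_of_nonneg_right this (hM k (by omega)).le
  simp at h1
  linarith

/-- A Dirichlet eigenvalue bound for a weighted path all of whose weights, up to a set of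
exceptional indices, are equal to `q`. -/
lemma dirichlet_path_bound (b : ℕ) (T M : ℕ → ℝ) (bad : Finset ℕ) (q N : ℝ)
    (hT0 : T 0 = 0) (hTb : T (b + 1) = 0) (hM : ∀ k ≤ b, 0 < M k)
    (hN : ∑ k ∈ range (b + 1), M k = N) (hq : 0 < q)
    (hgood : ∀ k < b, k + 1 ∉ bad → M k = q ∧ M (k + 1) = q) :
    (2 - 2 * Real.cos (Real.pi * q / N)) / q * ∑ k ∈ range (b + 1) \ bad, T k ^ 2 ≤
      ∑ k ∈ range (b + 1), (T (k + 1) - T k) ^ 2 / M k := by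
  have hNpos : 0 < N := by
    rw [← hN]
    exact sum_pos (fun k hk => hM k (by have := mem_range.1 hk; omega)) (by simp)
  set p : ℕ → ℝ := fun k => Real.pi / N * ∑ j ∈ range k, M j with hp
  have hpi := Real.pi_pos
  have hpN : p (b + 1) = Real.pi := by simp only [hp, hN]; field_simp
  have hp0 : p 0 = 0 := by simp [hp]
  have hstep : ∀ k, p (k + 1) = p k + Real.pi / N * M k := by
    intro k; simp only [hp, sum_range_succ]; ring
  have hlt : ∀ k ≤ b, p k < p (k + 1) := by
    intro k hk
    have := hM k hk
    rw [hstep]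
    have : 0 < Real.pi / N * M k := by positivity
    linarith
  have hpnn : ∀ k ≤ b + 1, 0 ≤ p k := by
    intro k hk
    refine mul_nonneg (by positivity) (sum_nonneg fun j hj => (hM j ?_).le)
    have := mem_range.1 hj; omega
  have hple : ∀ k ≤ b + 1, p k ≤ Real.pi := by
    intro k hk
    rw [← hpN]
    refine mul_le_mul_of_nonneg_left ?_ (by positivity)
    refine sum_le_sum_of_subset_of_nonneg (range_mono hk) fun j hj _ => (hM j ?_).le
    have := mem_range.1 hj; omega
  have hsinpos : ∀ k < b, 0 < Real.sin (p (k + 1)) := by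
    intro k hk
    refine Real.sin_pos_of_pos_of_lt_pi ?_ ?_
    · exact (hpnn k (by omega)).trans_lt (hlt k (by omega))
    · exact (hlt (k + 1) (by omega)).trans_le (hple _ (by omega))
  have hgs := ground_state_inequality b T (fun k => Real.sin (p k)) M hT0 hTb hM
    (fun k hk => Real.sin_nonneg_of_nonneg_of_le_pi (hpnn k hk) (hple k hk))
    (by
      intro k hk h
      rcases Nat.eq_zero_or_pos k with rfl | hk0
      · exact hT0
      · rcases hk.eq_or_lt with rfl | hk'
        · exact hTb
        · obtain ⟨j, rfl⟩ : ∃ j, k = j + 1 := ⟨k - 1, by omega⟩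
          exact absurd h (hsinpos j (by omega)).ne')
  refine le_trans ?_ hgs
  have hsum : ∑ k ∈ range (b + 1) \ bad, T k ^ 2 =
      ∑ k ∈ range b, if k + 1 ∈ bad then 0 else T (k + 1) ^ 2 := by
    rw [← filter_notMem_eq_sdiff, sum_filter, sum_range_succ']
    simp [hT0, ite_not]
  rw [hsum, mul_sum]
  refine sum_le_sum fun k hk => ?_
  have hk := mem_range.1 hk
  have hs := hsinpos k hk
  have hslope : (Real.sin (p (k + 2)) - Real.sin (p (k + 1))) / M (k + 1) ≤
      (Real.sin (p (k + 1)) - Real.sin (p k)) / M k := by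
    have h := strictConcaveOn_sin_Icc.concaveOn.slope_anti_adjacent
      (x := p k) (y := p (k + 1)) (z := p (k + 2)) ⟨hpnn k (by omega), hple k (by omega)⟩
      ⟨hpnn (k + 2) (by omega), hple (k + 2) (by omega)⟩ (hlt k (by omega))
      (hlt (k + 1) (by omega))
    have e1 : p (k + 2) - p (k + 1) = Real.pi / N * M (k + 1) := by
      rw [hstep (k + 1)]; ring
    have e2 : p (k + 1) - p k = Real.pi / N * M k := by
      rw [hstep k]; ring
    rw [e1, e2, mul_comm, mul_comm _ (M k), ← div_div, ← div_div] at h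
    exact (div_le_div_iff_of_pos_right (by positivity)).1 h
  split_ifs with hbad
  · rw [mul_zero]
    exact mul_nonneg (by linarith) (by positivity)
  · obtain ⟨h1, h2⟩ := hgood k hk hbad
    have e1 : p (k + 2) = p (k + 1) + Real.pi * q / N := by
      rw [hstep (k + 1), h2]; ring
    have e2 : p k = p (k + 1) - Real.pi * q / N := by
      have := hstep k
      rw [this, h1]; ring
    rw [h1, h2, e1, e2, Real.sin_add, Real.sin_sub]
    refine le_of_eq ?_
    field_simp
    ring

lemma sum_range_three_mul (f : ℕ → ℝ) (B : ℕ) :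
    ∑ i ∈ range (3 * B), f i =
      ∑ k ∈ range B, (f (3 * k) + f (3 * k + 1) + f (3 * k + 2)) := by
  induction B with
  | zero => simp
  | succ B ih =>
    rw [sum_range_succ, ← ih, show 3 * (B + 1) = 3 * B + 1 + 1 + 1 by ring, sum_range_succ,
      sum_range_succ, sum_range_succ]
    ring

lemma three_term_cauchy {a b c x y z : ℝ} (ha : 0 ≤ a) (hb : 0 ≤ b) (hc : 0 ≤ c) :
    (a * x + b * y + c * z) ^ 2 ≤ (a + b + c) * (a * x ^ 2 + b * y ^ 2 + c * z ^ 2) := by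
  nlinarith [mul_nonneg (mul_nonneg ha hb) (sq_nonneg (x - y)),
    mul_nonneg (mul_nonneg ha hc) (sq_nonneg (x - z)),
    mul_nonneg (mul_nonneg hb hc) (sq_nonneg (y - z))]

/-- A bound for the dissipation of the flow with divergence `m * y` on a path with edge resistances
`r`, when the masses and the resistances are periodic of period three up to exceptions. -/
lemma flow_energy_bound (b : ℕ) (m y r : ℕ → ℝ) (bad : Finset ℕ) (q N C τ δ : ℝ)
    (hm : ∀ i, 0 ≤ m i) (hr0 : ∀ i, 0 ≤ r i) (hr1 : ∀ i, r i ≤ 1) (hδ : 0 < δ) (hq : 0 < q) (hτ : 0 ≤ τ)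
    (hM : ∀ k ≤ b, 0 < m (3 * k) + m (3 * k + 1) + m (3 * k + 2))
    (hMC : ∀ k ≤ b, m (3 * k) + m (3 * k + 1) + m (3 * k + 2) ≤ C)
    (hN : ∑ i ∈ range (3 * (b + 1)), m i = N)
    (hsum : ∑ i ∈ range (3 * (b + 1)), m i * y i = 0)
    (hcos : Real.cos (Real.pi * q / N) < 1)
    (hgood : ∀ k < b, k + 1 ∉ bad →
      m (3 * k) + m (3 * k + 1) + m (3 * k + 2) = q ∧
      m (3 * (k + 1)) + m (3 * (k + 1) + 1) + m (3 * (k + 1) + 2) = q)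
    (hgood' : ∀ k ∈ range (b + 1) \ bad, r (3 * k) + r (3 * k + 1) + r (3 * k + 2) ≤ τ) :
    ∑ i ∈ range (3 * (b + 1)), r i * (∑ j ∈ range i, m j * y j) ^ 2 ≤
      ((1 + δ) * (τ * q / (2 - 2 * Real.cos (Real.pi * q / N)) + 3 * #bad * N)
        + (1 + 1 / δ) * (3 * C)) * ∑ i ∈ range (3 * (b + 1)), m i * y i ^ 2 := by
  set S : ℕ → ℝ := fun i => ∑ j ∈ range i, m j * y j with hS
  set e : ℕ → ℝ := fun k => m (3 * k) * y (3 * k) ^ 2 + m (3 * k + 1) * y (3 * k + 1) ^ 2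
    + m (3 * k + 2) * y (3 * k + 2) ^ 2 with he
  set M : ℕ → ℝ := fun k => m (3 * k) + m (3 * k + 1) + m (3 * k + 2) with hMdef
  set R : ℕ → ℝ := fun k => r (3 * k) + r (3 * k + 1) + r (3 * k + 2) with hRdef
  set T : ℕ → ℝ := fun k => S (3 * k) with hT
  have hE : ∑ i ∈ range (3 * (b + 1)), m i * y i ^ 2 = ∑ k ∈ range (b + 1), e k :=
    sum_range_three_mul _ _
  set E := ∑ k ∈ range (b + 1), e k with hEdef
  have hSsucc : ∀ i, S (i + 1) = S i + m i * y i := fun i => sum_range_succ _ _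
  have he0 : ∀ k, 0 ≤ e k := fun k => by
    have := hm (3 * k); have := hm (3 * k + 1); have := hm (3 * k + 2)
    positivity
  have hE0 : 0 ≤ E := sum_nonneg fun k _ => he0 k
  have hM0 : ∀ k, 0 ≤ M k := fun k => by
    have := hm (3 * k); have := hm (3 * k + 1); have := hm (3 * k + 2)
    positivity
  have hMN : ∑ k ∈ range (b + 1), M k = N := by rw [← hN, sum_range_three_mul]
  have hTstep : ∀ k, (T (k + 1) - T k) ^ 2 ≤ M k * e k := by
    intro k
    have : T (k + 1) - T k = m (3 * k) * y (3 * k) + m (3 * k + 1) * y (3 * k + 1)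
        + m (3 * k + 2) * y (3 * k + 2) := by
      simp only [hT, show 3 * (k + 1) = 3 * k + 1 + 1 + 1 by ring, hSsucc]
      ring
    rw [this]
    exact three_term_cauchy (hm _) (hm _) (hm _)
  have hS1 : ∀ k, (S (3 * k + 1) - T k) ^ 2 ≤ M k * e k := by
    intro k
    have h := three_term_cauchy (x := y (3 * k)) (y := 0) (z := 0) (hm (3 * k)) (hm (3 * k + 1))
      (hm (3 * k + 2))
    simp only [hT, hSsucc]
    have h1 := mul_nonneg (hM0 k) (mul_nonneg (hm (3 * k + 1)) (sq_nonneg (y (3 * k + 1))))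
    have h2 := mul_nonneg (hM0 k) (mul_nonneg (hm (3 * k + 2)) (sq_nonneg (y (3 * k + 2))))
    simp only [hMdef, he] at h1 h2 ⊢
    linarith
  have hS2 : ∀ k, (S (3 * k + 2) - T k) ^ 2 ≤ M k * e k := by
    intro k
    have h := three_term_cauchy (x := y (3 * k)) (y := y (3 * k + 1)) (z := 0) (hm (3 * k))
      (hm (3 * k + 1)) (hm (3 * k + 2))
    have h0 : S (3 * k + 2) - T k = m (3 * k) * y (3 * k) + m (3 * k + 1) * y (3 * k + 1) := by
      simp only [hT, show 3 * k + 2 = 3 * k + 1 + 1 by ring, hSsucc]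
      ring
    rw [h0]
    have h2 := mul_nonneg (hM0 k) (mul_nonneg (hm (3 * k + 2)) (sq_nonneg (y (3 * k + 2))))
    simp only [hMdef, he] at h2 ⊢
    linarith
  have hTE : ∑ k ∈ range (b + 1), (T (k + 1) - T k) ^ 2 / M k ≤ E := by
    refine sum_le_sum fun k hk => ?_
    have := hM k (by have := mem_range.1 hk; omega)
    exact (div_le_iff₀ this).2 (by rw [mul_comm]; exact hTstep k)
  have hT0 : T 0 = 0 := by simp [hT, hS]
  have hTb : T (b + 1) = 0 := hsum
  have hdir := dirichlet_path_bound b T M bad q N hT0 hTb hM hMN hq hgood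
  have hTbd : ∀ k ∈ range (b + 1), T k ^ 2 ≤ N * E := by
    intro k hk
    have hk := mem_range.1 hk
    have htel : T k = ∑ j ∈ range k, (T (j + 1) - T j) := by rw [sum_range_sub, hT0, sub_zero]
    have hN0 : 0 ≤ N := by rw [← hMN]; exact sum_nonneg fun k _ => hM0 k
    have h1 : (∑ j ∈ range k, (T (j + 1) - T j)) ^ 2 ≤
        (∑ j ∈ range k, M j) * ∑ j ∈ range k, e j := by
      have hb : ∀ j ∈ range k, 0 < M j := fun j hj => hM j (by have := mem_range.1 hj; omega)
      have h := sq_sum_div_le_sum_sq_div (range k) (fun j => T (j + 1) - T j) hb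
      rcases Nat.eq_zero_or_pos k with rfl | hk0
      · simp
      have hpos : 0 < ∑ j ∈ range k, M j := sum_pos hb (by simpa using hk0.ne')
      rw [div_le_iff₀ hpos] at h
      refine h.trans ?_
      rw [mul_comm]
      refine mul_le_mul_of_nonneg_left (sum_le_sum fun j hj => ?_) hpos.le
      exact (div_le_iff₀ (hb j hj)).2 (by rw [mul_comm]; exact hTstep j)
    rw [htel]
    refine h1.trans ?_
    have hsub : range k ⊆ range (b + 1) := range_mono hk.le
    refine mul_le_mul ?_ ?_ (sum_nonneg fun k _ => he0 k) hN0
    · rw [← hMN]; exact sum_le_sum_of_subset_of_nonneg hsub fun j _ _ => hM0 j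
    · exact sum_le_sum_of_subset_of_nonneg hsub fun j _ _ => he0 j
  have hR3 : ∀ k, R k ≤ 3 := fun k => by
    have := hr1 (3 * k); have := hr1 (3 * k + 1); have := hr1 (3 * k + 2)
    simp only [hRdef]; linarith
  have hN0 : 0 ≤ N := by rw [← hMN]; exact sum_nonneg fun k _ => hM0 k
  have hRT : ∑ k ∈ range (b + 1), R k * T k ^ 2 ≤
      (τ * q / (2 - 2 * Real.cos (Real.pi * q / N)) + 3 * #bad * N) * E := by
    have hsplit : ∑ k ∈ range (b + 1), R k * T k ^ 2 =
        ∑ k ∈ range (b + 1) \ bad, R k * T k ^ 2 + ∑ k ∈ range (b + 1) ∩ bad, R k * T k ^ 2 := by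
      rw [← sum_inter_add_sum_sdiff (range (b + 1)) bad, add_comm]
    have hbad : ∑ k ∈ range (b + 1) ∩ bad, R k * T k ^ 2 ≤ #bad * (3 * (N * E)) := by
      have h1 : ∑ k ∈ range (b + 1) ∩ bad, R k * T k ^ 2 ≤
          #(range (b + 1) ∩ bad) • (3 * (N * E)) := by
        refine sum_le_card_nsmul _ _ _ fun k hk => ?_
        exact mul_le_mul (hR3 k) (hTbd k (mem_inter.1 hk).1) (sq_nonneg _) (by norm_num)
      refine h1.trans ?_
      rw [nsmul_eq_mul]
      refine mul_le_mul_of_nonneg_right ?_ (by positivity)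
      exact_mod_cast card_le_card inter_subset_right
    have hgoodsum : ∑ k ∈ range (b + 1) \ bad, R k * T k ^ 2 ≤
        τ * q / (2 - 2 * Real.cos (Real.pi * q / N)) * E := by
      have h1 : ∑ k ∈ range (b + 1) \ bad, R k * T k ^ 2 ≤
          τ * ∑ k ∈ range (b + 1) \ bad, T k ^ 2 := by
        rw [mul_sum]
        exact sum_le_sum fun k hk => mul_le_mul_of_nonneg_right (hgood' k hk) (sq_nonneg _)
      refine h1.trans ?_
      have hc : 0 < 2 - 2 * Real.cos (Real.pi * q / N) := by linarith
      have h2 := hdir.trans hTE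
      have h3 : ∑ k ∈ range (b + 1) \ bad, T k ^ 2 ≤
          q / (2 - 2 * Real.cos (Real.pi * q / N)) * E := by
        rw [div_mul_eq_mul_div, le_div_iff₀ hc]
        rw [div_mul_eq_mul_div, div_le_iff₀ hq] at h2
        linarith
      calc _ ≤ τ * (q / (2 - 2 * Real.cos (Real.pi * q / N)) * E) :=
            mul_le_mul_of_nonneg_left h3 hτ
        _ = _ := by ring
    rw [hsplit]
    linarith
  rw [hE, sum_range_three_mul]
  have hblock : ∀ k ∈ range (b + 1), r (3 * k) * S (3 * k) ^ 2 + r (3 * k + 1) * S (3 * k + 1) ^ 2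
      + r (3 * k + 2) * S (3 * k + 2) ^ 2 ≤
      (1 + δ) * (R k * T k ^ 2) + (1 + 1 / δ) * (3 * C) * e k := by
    intro k hk
    have hk := mem_range.1 hk
    have key : ∀ i, (S i - T k) ^ 2 ≤ M k * e k →
        r i * S i ^ 2 ≤ (1 + δ) * (r i * T k ^ 2) + (1 + 1 / δ) * (C * e k) := by
      intro i hi
      have h1 := add_sq_le_weighted hδ (T k) (S i - T k)
      rw [add_sub_cancel] at h1
      have h2 : M k * e k ≤ C * e k := mul_le_mul_of_nonneg_right (hMC k (by omega)) (he0 k)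
      have h3 : 0 ≤ C * e k := (mul_nonneg (hM0 k) (he0 k)).trans h2
      have h4 : r i * (S i - T k) ^ 2 ≤ C * e k := by
        calc r i * (S i - T k) ^ 2 ≤ 1 * (S i - T k) ^ 2 :=
              mul_le_mul_of_nonneg_right (hr1 i) (sq_nonneg _)
          _ ≤ _ := by linarith
      have h5 := mul_le_mul_of_nonneg_left h1 (hr0 i)
      have h6 := mul_le_mul_of_nonneg_left h4 (show 0 ≤ 1 + 1 / δ by positivity)
      linarith
    have h0 := key (3 * k) (by
      simp only [hT, sub_self]
      simpa using mul_nonneg (hM0 k) (he0 k))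
    have h1 := key (3 * k + 1) (hS1 k)
    have h2 := key (3 * k + 2) (hS2 k)
    simp only [hRdef]
    linarith
  refine (sum_le_sum hblock).trans ?_
  rw [sum_add_distrib, ← mul_sum, ← mul_sum]
  have := mul_le_mul_of_nonneg_left hRT (show 0 ≤ 1 + δ by positivity)
  linarith

lemma sum_mul_sq_by_parts (m y : ℕ → ℝ) (L : ℕ) :
    ∑ i ∈ range (L + 1), m i * y i ^ 2 = (∑ j ∈ range (L + 1), m j * y j) * y L
      - ∑ i ∈ range L, (∑ j ∈ range (i + 1), m j * y j) * (y (i + 1) - y i) := by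
  induction L with
  | zero => simp; ring
  | succ L ih =>
    rw [sum_range_succ, ih, sum_range_succ (fun j => m j * y j) (L + 1),
      sum_range_succ (fun i => (∑ j ∈ range (i + 1), m j * y j) * (y (i + 1) - y i)) L]
    ring

/-- Thomson's principle on a path: a bound for the dissipation of the flow with divergence `m * y`
gives a Poincaré inequality. -/
lemma poincare_of_flow_bound (m y c r : ℕ → ℝ) (L : ℕ) (Λ Q : ℝ) (hm : ∀ i, 0 ≤ m i)
    (hΛ : 0 ≤ Λ) (hQ : 0 ≤ Q) (hr0 : ∀ i, 0 ≤ r i) (hc0 : ∀ i, 0 ≤ c i)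
    (hsum : ∑ i ∈ range (L + 1), m i * y i = 0)
    (hcr : ∀ i < L, ∑ j ∈ range (i + 1), m j * y j = 0 ∨ c i * r (i + 1) = 1)
    (henergy : ∑ i ∈ range L, c i * (y (i + 1) - y i) ^ 2 ≤ Q)
    (hflow : ∑ i ∈ range (L + 1), r i * (∑ j ∈ range i, m j * y j) ^ 2 ≤
      Λ * ∑ i ∈ range (L + 1), m i * y i ^ 2) :
    ∑ i ∈ range (L + 1), m i * y i ^ 2 ≤ Λ * Q := by
  set E := ∑ i ∈ range (L + 1), m i * y i ^ 2 with hE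
  have hE0 : 0 ≤ E := sum_nonneg fun i _ => mul_nonneg (hm i) (sq_nonneg _)
  have hparts := sum_mul_sq_by_parts m y L
  rw [hsum, zero_mul, zero_sub, ← hE] at hparts
  have hcs : (∑ i ∈ range L, (∑ j ∈ range (i + 1), m j * y j) * (y (i + 1) - y i)) ^ 2 ≤
      (∑ i ∈ range L, r (i + 1) * (∑ j ∈ range (i + 1), m j * y j) ^ 2) *
        ∑ i ∈ range L, c i * (y (i + 1) - y i) ^ 2 := by
    refine sum_sq_le_sum_mul_sum_of_sq_le_mul _ (fun i _ => ?_) (fun i hi => ?_) (fun i hi => ?_)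
    · exact mul_nonneg (hr0 _) (sq_nonneg _)
    · exact mul_nonneg (hc0 _) (sq_nonneg _)
    · rcases hcr i (mem_range.1 hi) with h | h
      · simp [h]
      · refine le_of_eq ?_
        linear_combination (-(∑ j ∈ range (i + 1), m j * y j) ^ 2 * (y (i + 1) - y i) ^ 2) * h
  have hflow' : ∑ i ∈ range L, r (i + 1) * (∑ j ∈ range (i + 1), m j * y j) ^ 2 ≤ Λ * E := by
    rw [sum_range_succ'] at hflow
    simpa using hflow
  have h : E ^ 2 ≤ Λ * E * Q := by
    rw [hparts, neg_sq, ← hparts]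
    exact hcs.trans (mul_le_mul hflow' henergy
      (sum_nonneg fun i _ => mul_nonneg (hc0 i) (sq_nonneg _)) (mul_nonneg hΛ hE0))
  rcases hE0.eq_or_lt with h0 | h0
  · rw [← h0]; positivity
  · refine le_of_mul_le_mul_right (a := E) ?_ h0
    linarith

end OneDimensional

open scoped Classical in
lemma sum_adj_eq_two_mul_lapQ {V : Type*} [Fintype V] (G : SimpleGraph V) (x : V → ℝ) :
    ∑ v, ∑ w, (if G.Adj v w then (x v - x w) ^ 2 else 0) = 2 * lapQ G x := by
  have h := G.lapMatrix_toLinearMap₂' ℝ x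
  rw [Matrix.toLinearMap₂'_apply'] at h
  have h2 : lapQ G x = x ⬝ᵥ (G.lapMatrix ℝ *ᵥ x) := rfl
  rw [h2, h]
  ring

lemma lapQ_nonneg {V : Type*} [Fintype V] (G : SimpleGraph V) (x : V → ℝ) : 0 ≤ lapQ G x := by
  classical
  have h := sum_adj_eq_two_mul_lapQ G x
  have : 0 ≤ ∑ v, ∑ w, (if G.Adj v w then (x v - x w) ^ 2 else 0) :=
    sum_nonneg fun v _ => sum_nonneg fun w _ => by split_ifs <;> positivity
  linarith

open scoped Classical in
/-- The difference of a function along a path is controlled by its energy. -/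
lemma sq_sub_le_card_mul_lapQ {V : Type*} [Fintype V] {G : SimpleGraph V} (hG : G.Connected)
    (x : V → ℝ) (a b : V) : (x a - x b) ^ 2 ≤ Fintype.card V * (2 * lapQ G x) := by
  obtain ⟨p, hp⟩ := hG.exists_isPath a b
  have htel : x b - x a = ∑ i ∈ range p.length, (x (p.getVert (i + 1)) - x (p.getVert i)) := by
    rw [sum_range_sub (fun i => x (p.getVert i))]
    simp
  have h1 : (x a - x b) ^ 2 ≤
      p.length * ∑ i ∈ range p.length, (x (p.getVert (i + 1)) - x (p.getVert i)) ^ 2 := by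
    rw [← neg_sub, neg_sq, htel]
    simpa using sq_sum_le_card_mul_sum_sq (s := range p.length)
      (f := fun i => x (p.getVert (i + 1)) - x (p.getVert i))
  have h2 : ∑ i ∈ range p.length, (x (p.getVert (i + 1)) - x (p.getVert i)) ^ 2 ≤
      2 * lapQ G x := by
    rw [← sum_adj_eq_two_mul_lapQ, ← sum_product']
    have hinj : Set.InjOn (fun i => (p.getVert i, p.getVert (i + 1))) (range p.length) := by
      intro i hi j hj hij
      simp only [coe_range, Set.mem_Iio] at hi hj
      exact hp.getVert_injOn (by simpa using hi.le) (by simpa using hj.le) (Prod.ext_iff.1 hij).1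
    have h3 : ∑ i ∈ range p.length, (x (p.getVert (i + 1)) - x (p.getVert i)) ^ 2 =
        ∑ e ∈ (range p.length).image (fun i => (p.getVert i, p.getVert (i + 1))),
          (if G.Adj e.1 e.2 then (x e.1 - x e.2) ^ 2 else 0) := by
      rw [sum_image hinj]
      refine sum_congr rfl fun i hi => ?_
      rw [if_pos (p.adj_getVert_succ (mem_range.1 hi))]
      ring
    rw [h3]
    refine sum_le_sum_of_subset_of_nonneg (by simp) fun e _ _ => ?_
    split_ifs <;> positivity
  refine h1.trans (mul_le_mul ?_ h2 (sum_nonneg fun i _ => sq_nonneg _) (by positivity))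
  exact_mod_cast hp.length_lt.le

/-- A layering of a graph: a function changing by at most one along edges, together with a path
meeting each layer once. -/
structure Layering {V : Type*} (G : SimpleGraph V) (l : V → ℕ) (p : ℕ → V) (H : ℕ) : Prop where
  one_le : ∀ v, 1 ≤ l v
  le_top : ∀ v, l v ≤ H
  adj : ∀ v w, G.Adj v w → l w ≤ l v + 1
  level : ∀ i, 1 ≤ i → i ≤ H → l (p i) = i
  path_adj : ∀ i, 1 ≤ i → i + 1 ≤ H → G.Adj (p i) (p (i + 1))

lemma exists_layering {V : Type*} [Finite V] {G : SimpleGraph V} (hG : G.Connected) :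
    ∃ l p, Layering G l p (G.diam + 1) := by
  have := hG.nonempty
  obtain ⟨u, v, huv⟩ := G.exists_dist_eq_diam
  obtain ⟨q, hq⟩ := hG.exists_walk_length_eq_dist u v
  refine ⟨fun w => G.dist u w + 1, fun i => q.getVert (i - 1), ?_, ?_, ?_, ?_, ?_⟩
  · intro w; omega
  · intro w
    have := G.dist_le_diam (u := u) (v := w) (SimpleGraph.connected_iff_ediam_ne_top.1 hG)
    omega
  · intro a b hab
    have h1 := hG.dist_triangle (u := u) (v := a) (w := b)
    rw [SimpleGraph.dist_eq_one_iff_adj.2 hab] at h1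
    omega
  · intro i h1 h2
    have h3 := SimpleGraph.dist_le (q.take (i - 1))
    have h4 := SimpleGraph.dist_le (q.drop (i - 1))
    have h5 := hG.dist_triangle (u := u) (v := q.getVert (i - 1)) (w := v)
    rw [SimpleGraph.Walk.take_length] at h3
    rw [SimpleGraph.Walk.drop_length] at h4
    omega
  · intro i h1 h2
    have := q.adj_getVert_succ (i := i - 1) (by omega)
    rwa [show i - 1 + 1 = i + 1 - 1 by omega] at this

section Layers

variable {V : Type*} [Fintype V] {G : SimpleGraph V} {l : V → ℕ} {p : ℕ → V} {H d : ℕ}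

/-- The vertices in layer `i`. -/
def layer {V : Type*} [Fintype V] (l : V → ℕ) (i : ℕ) : Finset V := {v | l v = i}

/-- The vertices in layers `i - 1`, `i` and `i + 1`. -/
def window {V : Type*} [Fintype V] (l : V → ℕ) (i : ℕ) : Finset V :=
  {v | i ≤ l v + 1 ∧ l v ≤ i + 1}

/-- Layer `i` is tight if a closed neighborhood fills the three layers around it. -/
def Tight {V : Type*} [Fintype V] (l : V → ℕ) (H d i : ℕ) : Prop :=
  1 ≤ i ∧ i ≤ H ∧ #(window l i) = d + 1

@[simp] lemma mem_layer {i : ℕ} {v : V} : v ∈ layer l i ↔ l v = i := by simp [layer]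

@[simp] lemma mem_window {i : ℕ} {v : V} : v ∈ window l i ↔ i ≤ l v + 1 ∧ l v ≤ i + 1 := by
  simp [window]

lemma card_window {i : ℕ} (hi : 1 ≤ i) :
    #(window l i) = #(layer l (i - 1)) + #(layer l i) + #(layer l (i + 1)) := by
  classical
  rw [← card_union_of_disjoint, ← card_union_of_disjoint]
  · congr 1
    ext v
    simp only [mem_window, mem_union, mem_layer]
    omega
  · rw [Finset.disjoint_left]
    intro v
    simp only [mem_union, mem_layer]
    omega
  · rw [Finset.disjoint_left]
    intro v
    simp only [mem_layer]
    omega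

lemma card_layer_le_card_window (i : ℕ) : #(layer l i) ≤ #(window l i) := by
  refine card_le_card fun v => ?_
  simp only [mem_window, mem_layer]
  omega

lemma Layering.card_layer_pos (hL : Layering G l p H) {i : ℕ} (h1 : 1 ≤ i) (h2 : i ≤ H) :
    0 < #(layer l i) := card_pos.2 ⟨p i, mem_layer.2 (hL.level i h1 h2)⟩

lemma Layering.closedNeighborSet_subset (hL : Layering G l p H) (v : V) :
    insert v (G.neighborSet v) ⊆ (window l (l v) : Set V) := by
  intro w hw
  simp only [SetLike.mem_coe, mem_window]
  rcases hw with rfl | hw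
  · omega
  · have := hL.adj v w hw
    have := hL.adj w v (SimpleGraph.Adj.symm hw)
    omega

lemma ncard_closedNeighborSet (hreg : ∀ v, (G.neighborSet v).ncard = d) (v : V) :
    (insert v (G.neighborSet v)).ncard = d + 1 := by
  rw [Set.ncard_insert_of_notMem (by simp), hreg]

lemma Layering.le_card_window (hL : Layering G l p H) (hreg : ∀ v, (G.neighborSet v).ncard = d)
    {i : ℕ} (h1 : 1 ≤ i) (h2 : i ≤ H) : d + 1 ≤ #(window l i) := by
  have h := Set.ncard_le_ncard (hL.closedNeighborSet_subset (p i)) (finite_toSet _)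
  rwa [ncard_closedNeighborSet hreg, Set.ncard_coe_finset, hL.level i h1 h2] at h

lemma Layering.adj_of_tight (hL : Layering G l p H) (hreg : ∀ v, (G.neighborSet v).ncard = d)
    {v w : V} (ht : Tight l H d (l v)) (hw : w ∈ window l (l v)) (hne : w ≠ v) : G.Adj v w := by
  have h := Set.eq_of_subset_of_ncard_le (hL.closedNeighborSet_subset v)
    (by rw [ncard_closedNeighborSet hreg, Set.ncard_coe_finset, ht.2.2]) (finite_toSet _)
  have hw' : w ∈ insert v (G.neighborSet v) := by rw [h]; exact hw
  exact hw'.resolve_left hne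

lemma sum_card_window_le (l : V → ℕ) (H : ℕ) :
    ∑ i ∈ Icc 1 H, #(window l i) ≤ 3 * Fintype.card V := by
  have h : ∑ i ∈ Icc 1 H, #(window l i) = ∑ v : V, #{i ∈ Icc 1 H | i ≤ l v + 1 ∧ l v ≤ i + 1} :=
    sum_card_bipartiteAbove_eq_sum_card_bipartiteBelow
      (fun i v => i ≤ l v + 1 ∧ l v ≤ i + 1)
  rw [h, mul_comm, ← smul_eq_mul]
  refine sum_le_card_nsmul _ _ _ fun v _ => ?_
  have : ({i ∈ Icc 1 H | i ≤ l v + 1 ∧ l v ≤ i + 1} : Finset ℕ) ⊆ Icc (l v - 1) (l v + 1) := by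
    intro i
    simp only [mem_filter, mem_Icc]
    omega
  refine (card_le_card this).trans ?_
  simp only [Nat.card_Icc]
  omega

open scoped Classical in
lemma Layering.card_not_tight_le (hL : Layering G l p H)
    (hreg : ∀ v, (G.neighborSet v).ncard = d) {K : ℕ}
    (hK : 3 * Fintype.card V ≤ H * (d + 1) + K) :
    #{i ∈ Icc 1 H | ¬ Tight l H d i} ≤ K := by
  have h1 := sum_card_window_le l H
  have h2 : ∑ i ∈ Icc 1 H, ((d + 1) + if Tight l H d i then 0 else 1) ≤
      ∑ i ∈ Icc 1 H, #(window l i) := by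
    refine sum_le_sum fun i hi => ?_
    have hi := mem_Icc.1 hi
    have := hL.le_card_window hreg hi.1 hi.2
    split_ifs with h
    · omega
    · have : #(window l i) ≠ d + 1 := fun h' => h ⟨hi.1, hi.2, h'⟩
      omega
  rw [sum_add_distrib, sum_const, Nat.card_Icc, Nat.add_sub_cancel, smul_eq_mul] at h2
  rw [card_filter]
  simp only [ite_not]
  omega

lemma Layering.card_window_le (hL : Layering G l p H)
    (hreg : ∀ v, (G.neighborSet v).ncard = d) {K : ℕ}
    (hK : 3 * Fintype.card V ≤ H * (d + 1) + K) {i : ℕ} (h1 : 1 ≤ i) (h2 : i ≤ H) :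
    #(window l i) ≤ d + 1 + K := by
  have h3 := sum_card_window_le l H
  have hi : i ∈ Icc 1 H := mem_Icc.2 ⟨h1, h2⟩
  rw [← add_sum_erase _ _ hi] at h3
  have h4 : #((Icc 1 H).erase i) • (d + 1) ≤ ∑ j ∈ (Icc 1 H).erase i, #(window l j) := by
    refine card_nsmul_le_sum _ _ _ fun j hj => ?_
    have hj := mem_Icc.1 (mem_of_mem_erase hj)
    exact hL.le_card_window hreg hj.1 hj.2
  rw [card_erase_of_mem hi, Nat.card_Icc, Nat.add_sub_cancel, smul_eq_mul] at h4
  obtain ⟨j, rfl⟩ : ∃ j, H = j + 1 := ⟨H - 1, by omega⟩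
  rw [Nat.add_sub_cancel] at h4
  rw [add_mul] at hK
  omega

/-- In a graph all of whose degrees are even, two consecutive layers joined completely are not both
singletons, as they would form a bridge. -/
lemma Layering.card_mul_card_ne_one (hL : Layering G l p H)
    (hreg : ∀ v, (G.neighborSet v).ncard = d) (hd : Even d) {i : ℕ} (h1 : 1 ≤ i)
    (h2 : i + 1 ≤ H) (hi : #(layer l i) = 1) : #(layer l (i + 1)) ≠ 1 := by
  classical
  intro hi'
  have hp : ∀ v, l v = i → v = p i := fun v hv =>
    card_le_one.1 hi.le v (mem_layer.2 hv) (p i) (mem_layer.2 (hL.level i h1 (by omega)))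
  have hq : ∀ v, l v = i + 1 → v = p (i + 1) := fun v hv =>
    card_le_one.1 hi'.le v (mem_layer.2 hv) (p (i + 1)) (mem_layer.2 (hL.level (i + 1) (by omega) h2))
  have hlp := hL.level i h1 (by omega)
  have hlq := hL.level (i + 1) (by omega) h2
  let G' : SimpleGraph V :=
    { Adj := fun v w => G.Adj v w ∧ l v ≤ i ∧ l w ≤ i
      symm := ⟨fun v w h => ⟨h.1.symm, h.2.2, h.2.1⟩⟩
      loopless := ⟨fun v h => G.loopless.irrefl v h.1⟩ }
  have hdeg : ∀ v, G'.degree v = (G'.neighborSet v).ncard := fun v => by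
    rw [← SimpleGraph.card_neighborFinset_eq_degree, ← Set.ncard_coe_finset,
      SimpleGraph.coe_neighborFinset]
  have hodd : ∀ v, Odd (G'.degree v) ↔ v = p i := by
    intro v
    rw [hdeg]
    by_cases hv : l v ≤ i
    · by_cases hvp : v = p i
      · have : G'.neighborSet v = G.neighborSet v \ {p (i + 1)} := by
          ext w
          simp only [SimpleGraph.mem_neighborSet, G', Set.mem_sdiff, Set.mem_singleton_iff]
          constructor
          · rintro ⟨h, -, h'⟩
            exact ⟨h, by rintro rfl; omega⟩
          · rintro ⟨h, h'⟩
            refine ⟨h, hv, ?_⟩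
            have h3 := hL.adj v w h
            by_contra hcon
            exact h' (hq w (by subst hvp; omega))
        rw [this, Set.ncard_sdiff_singleton_of_mem, hreg]
        · simp only [hvp, iff_true]
          have : 0 < d := by
            rw [← hreg (p i), Set.ncard_pos]
            exact ⟨_, hL.path_adj i h1 h2⟩
          exact Nat.Even.sub_odd this hd odd_one
        · rw [hvp]; exact hL.path_adj i h1 h2
      · have : G'.neighborSet v = G.neighborSet v := by
          ext w
          simp only [SimpleGraph.mem_neighborSet, G']
          refine ⟨fun h => h.1, fun h => ⟨h, hv, ?_⟩⟩
          have h3 := hL.adj v w h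
          have : l v ≠ i := fun h => hvp (hp v h)
          omega
        rw [this, hreg]
        simp only [hvp, iff_false, Nat.not_odd_iff_even]
        exact hd
    · have : G'.neighborSet v = ∅ := by
        ext w
        simp only [SimpleGraph.mem_neighborSet, G', Set.mem_empty_iff_false, iff_false]
        exact fun h => hv h.2.1
      rw [this]
      simp only [Set.ncard_empty, Nat.not_odd_zero, false_iff]
      rintro rfl
      omega
  have h := G'.even_card_odd_degree_vertices
  have hsingle : ({v | Odd (G'.degree v)} : Finset V) = {p i} := by
    ext v
    simp [hodd]
  rw [hsingle, card_singleton] at h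
  exact absurd h (by decide)

open scoped Classical in
/-- Representatives of layer `i`: the whole layer if it is tight, and otherwise a vertex of the path
that accompanies the layering. -/
noncomputable def rep {V : Type*} [Fintype V] (l : V → ℕ) (p : ℕ → V) (H d i : ℕ) : Finset V :=
  if Tight l H d i then layer l i else if 1 ≤ i ∧ i ≤ H then {p i} else ∅

/-- The mean of `x` over the finset `A`. -/
noncomputable def meanOn {V : Type*} (x : V → ℝ) (A : Finset V) : ℝ := (∑ v ∈ A, x v) / #A

lemma card_mul_card_mul_sq_meanOn_sub_le {V : Type*} (x : V → ℝ) (A B : Finset V) :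
    (#A * #B : ℝ) * (meanOn x B - meanOn x A) ^ 2 ≤ ∑ v ∈ A, ∑ w ∈ B, (x v - x w) ^ 2 := by
  rcases A.eq_empty_or_nonempty with rfl | hA
  · simp
  rcases B.eq_empty_or_nonempty with rfl | hB
  · simp
  have hA0 : (0 : ℝ) < #A := by exact_mod_cast hA.card_pos
  have hB0 : (0 : ℝ) < #B := by exact_mod_cast hB.card_pos
  have h := sq_sum_le_card_mul_sum_sq (s := A ×ˢ B) (f := fun e => x e.1 - x e.2)
  rw [sum_product, sum_product, card_product] at h
  have h2 : ∑ v ∈ A, ∑ w ∈ B, (x v - x w) = #A * #B * (meanOn x A - meanOn x B) := by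
    simp only [sum_sub_distrib, sum_const, nsmul_eq_mul, ← mul_sum, meanOn]
    field_simp
  simp only [h2] at h
  push_cast at h
  refine le_of_mul_le_mul_left (a := (#A * #B : ℝ)) ?_ (by positivity)
  linarith

lemma sq_sub_meanOn_le {V : Type*} (x : V → ℝ) (A : Finset V) (hA : A.Nonempty) (a c : ℝ)
    (h : ∀ w ∈ A, (a - x w) ^ 2 ≤ c) : (a - meanOn x A) ^ 2 ≤ c := by
  have hA0 : (0 : ℝ) < #A := by exact_mod_cast hA.card_pos
  have h1 := sq_sum_le_card_mul_sum_sq (s := A) (f := fun w => a - x w)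
  have h2 : ∑ w ∈ A, (a - x w) = #A * (a - meanOn x A) := by
    simp only [sum_sub_distrib, sum_const, nsmul_eq_mul, meanOn]
    field_simp
  have h3 := sum_le_card_nsmul A _ c h
  rw [h2] at h1
  rw [nsmul_eq_mul] at h3
  have h4 := mul_le_mul_of_nonneg_left h3 hA0.le
  refine le_of_mul_le_mul_left (a := (#A * #A : ℝ)) ?_ (by positivity)
  linarith

lemma rep_of_tight {i : ℕ} (h : Tight l H d i) : rep l p H d i = layer l i := by simp [rep, h]

lemma Layering.rep_subset (hL : Layering G l p H) (i : ℕ) : rep l p H d i ⊆ layer l i := by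
  unfold rep
  split_ifs with h1 h2
  · exact subset_rfl
  · simpa using hL.level i h2.1 h2.2
  · simp

lemma Layering.rep_nonempty (hL : Layering G l p H) {i : ℕ} (h1 : 1 ≤ i) (h2 : i ≤ H) :
    (rep l p H d i).Nonempty := by
  unfold rep
  split_ifs with h h'
  · exact ⟨p i, mem_layer.2 (hL.level i h1 h2)⟩
  · exact singleton_nonempty _
  · omega

lemma Layering.adj_of_mem_rep (hL : Layering G l p H)
    (hreg : ∀ v, (G.neighborSet v).ncard = d) {i : ℕ} {v w : V} (hv : v ∈ rep l p H d i)
    (hw : w ∈ rep l p H d (i + 1)) : G.Adj v w := by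
  have hlv := mem_layer.1 (hL.rep_subset i hv)
  have hlw := mem_layer.1 (hL.rep_subset (i + 1) hw)
  by_cases h1 : Tight l H d i
  · refine hL.adj_of_tight hreg (by rwa [hlv]) (mem_window.2 (by omega)) ?_
    rintro rfl; omega
  by_cases h2 : Tight l H d (i + 1)
  · refine (hL.adj_of_tight hreg (by rwa [hlw]) (mem_window.2 (by omega)) ?_).symm
    rintro rfl; omega
  have h3 := hL.one_le v
  have h4 := hL.le_top w
  rw [rep, if_neg h1, if_pos ⟨by omega, by omega⟩, mem_singleton] at hv
  rw [rep, if_neg h2, if_pos ⟨by omega, by omega⟩, mem_singleton] at hw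
  rw [hv, hw]
  exact hL.path_adj i (by omega) (by omega)

lemma Layering.sum_energy_le (hL : Layering G l p H)
    (hreg : ∀ v, (G.neighborSet v).ncard = d) (x : V → ℝ) (L : ℕ) :
    ∑ i ∈ range L, (#(rep l p H d i) * #(rep l p H d (i + 1)) : ℝ) *
      (meanOn x (rep l p H d (i + 1)) - meanOn x (rep l p H d i)) ^ 2 ≤ lapQ G x := by
  classical
  set g : V → ℝ := fun v => ∑ w, if G.Adj v w ∧ l w = l v + 1 then (x v - x w) ^ 2 else 0 with hg
  have hg0 : ∀ v, 0 ≤ g v := fun v => sum_nonneg fun w _ => by split_ifs <;> positivity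
  have hup : ∑ v, g v ≤ lapQ G x := by
    have hdown : ∑ v, g v =
        ∑ v, ∑ w, if G.Adj v w ∧ l v = l w + 1 then (x v - x w) ^ 2 else 0 := by
      rw [sum_comm]
      refine sum_congr rfl fun v _ => sum_congr rfl fun w _ => ?_
      rw [G.adj_comm, ← neg_sub, neg_sq]
    have h2 := sum_adj_eq_two_mul_lapQ G x
    have h3 : ∑ v, g v +
        ∑ v, ∑ w, (if G.Adj v w ∧ l v = l w + 1 then (x v - x w) ^ 2 else 0) ≤
        ∑ v, ∑ w, (if G.Adj v w then (x v - x w) ^ 2 else 0) := by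
      simp only [hg, ← sum_add_distrib]
      refine sum_le_sum fun v _ => sum_le_sum fun w _ => ?_
      have hsq := sq_nonneg (x v - x w)
      by_cases h : G.Adj v w
      · simp only [h, true_and, if_true]
        split_ifs <;> first | omega | linarith
      · simp [h]
    linarith
  have hi : ∀ i, (#(rep l p H d i) * #(rep l p H d (i + 1)) : ℝ) *
      (meanOn x (rep l p H d (i + 1)) - meanOn x (rep l p H d i)) ^ 2 ≤
      ∑ v, if l v = i then g v else 0 := by
    intro i
    refine (card_mul_card_mul_sq_meanOn_sub_le x _ _).trans ?_
    rw [← sum_filter]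
    refine (sum_le_sum fun v hv => ?_).trans
      (sum_le_sum_of_subset_of_nonneg (hL.rep_subset i) fun v _ _ => hg0 v)
    simp only [hg]
    rw [← sum_filter]
    refine sum_le_sum_of_subset_of_nonneg (fun w hw => ?_) fun w _ _ => sq_nonneg _
    have hlv := mem_layer.1 (hL.rep_subset i hv)
    have hlw := mem_layer.1 (hL.rep_subset (i + 1) hw)
    exact mem_filter.2 ⟨mem_univ _, hL.adj_of_mem_rep hreg hv hw, by omega⟩
  refine (sum_le_sum fun i _ => hi i).trans ?_
  rw [sum_comm]
  refine le_trans (sum_le_sum fun v _ => ?_) hup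
  rw [sum_ite_eq]
  split_ifs
  · exact le_rfl
  · exact hg0 v

open scoped Classical in
lemma Layering.card_not_tight_vertices_le (hL : Layering G l p H)
    (hreg : ∀ v, (G.neighborSet v).ncard = d) {K : ℕ}
    (hK : 3 * Fintype.card V ≤ H * (d + 1) + K) :
    #{v | ¬ Tight l H d (l v)} ≤ (d + 1 + K) * K := by
  have h := card_le_mul_card_image_of_maps_to (s := {v | ¬ Tight l H d (l v)})
    (t := {i ∈ Icc 1 H | ¬ Tight l H d i}) (f := l) (fun v hv => by
      have hv := (mem_filter.1 hv).2
      exact mem_filter.2 ⟨mem_Icc.2 ⟨hL.one_le v, hL.le_top v⟩, hv⟩) (d + 1 + K)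
    (fun i hi => by
      have hi := mem_Icc.1 (mem_filter.1 hi).1
      refine le_trans (card_le_card fun v hv => ?_)
        ((card_layer_le_card_window i).trans (hL.card_window_le hreg hK hi.1 hi.2))
      exact mem_layer.2 (mem_filter.1 hv).2)
  exact h.trans (Nat.mul_le_mul_left _ (hL.card_not_tight_le hreg hK))

lemma Layering.sum_sq_sub_meanOn_rep_le (hL : Layering G l p H) (hG : G.Connected)
    (hreg : ∀ v, (G.neighborSet v).ncard = d) {K : ℕ}
    (hK : 3 * Fintype.card V ≤ H * (d + 1) + K) (x : V → ℝ) :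
    ∑ v, (x v - meanOn x (rep l p H d (l v))) ^ 2 ≤
      (1 + (d + 1 + K) * K * Fintype.card V) * (2 * lapQ G x) := by
  classical
  have hQ := lapQ_nonneg G x
  have hpt : ∀ v, (x v - meanOn x (rep l p H d (l v))) ^ 2 ≤
      (∑ w, if G.Adj v w then (x v - x w) ^ 2 else 0) +
        if ¬ Tight l H d (l v) then Fintype.card V * (2 * lapQ G x) else 0 := by
    intro v
    have hnn : ∀ w, 0 ≤ (if G.Adj v w then (x v - x w) ^ 2 else 0) := fun w => by
      split_ifs <;> positivity
    refine sq_sub_meanOn_le x _ (hL.rep_nonempty (hL.one_le v) (hL.le_top v)) _ _ fun w hw => ?_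
    split_ifs with ht
    · rw [rep_of_tight ht, mem_layer] at hw
      rw [add_zero]
      by_cases hwv : w = v
      · subst hwv
        simpa using sum_nonneg fun w (_ : w ∈ univ) => hnn w
      · have hadj := hL.adj_of_tight hreg ht (w := w) (mem_window.2 (by omega)) hwv
        have := single_le_sum (fun w _ => hnn w) (mem_univ w)
        simpa [hadj] using this
    · have := sq_sub_le_card_mul_lapQ hG x v w
      have := sum_nonneg fun w (_ : w ∈ univ) => hnn w
      linarith
  refine (sum_le_sum fun v _ => hpt v).trans ?_
  rw [sum_add_distrib, sum_adj_eq_two_mul_lapQ, ← sum_filter, sum_const, nsmul_eq_mul]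
  have h1 : (#{v | ¬ Tight l H d (l v)} : ℝ) ≤ (d + 1 + K) * K := by
    exact_mod_cast hL.card_not_tight_vertices_le hreg hK
  have h2 := mul_le_mul_of_nonneg_right h1
    (show 0 ≤ (Fintype.card V : ℝ) * (2 * lapQ G x) by positivity)
  linarith

lemma two_mul_sub_two_le_mul_mul {a b c d : ℕ} (ha : 1 ≤ a) (hb : 1 ≤ b) (hc : 1 ≤ c)
    (habc : a + b + c = d + 1) (hab : a = 1 → b ≠ 1) (hbc : b = 1 → c ≠ 1) (hca : c = 1 → a ≠ 1) :
    2 * ((d : ℝ) - 2) ≤ a * b * c := by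
  have key : ∀ u v : ℕ, 2 ≤ u → 2 ≤ v → u + v = d → 2 * ((d : ℝ) - 2) ≤ u * v := by
    intro u v hu hv huv
    obtain ⟨u, rfl⟩ := Nat.exists_eq_add_of_le hu
    obtain ⟨v, rfl⟩ := Nat.exists_eq_add_of_le hv
    subst huv
    have : (0 : ℝ) ≤ u * v := by positivity
    push_cast
    linarith
  rcases ha.eq_or_lt with rfl | ha
  · simpa using key b c (by omega) (by omega) (by omega)
  rcases hb.eq_or_lt with rfl | hb
  · simpa using key a c (by omega) (by omega) (by omega)
  rcases hc.eq_or_lt with rfl | hc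
  · simpa using key a b (by omega) (by omega) (by omega)
  obtain ⟨a, rfl⟩ := Nat.exists_eq_add_of_lt ha
  obtain ⟨b, rfl⟩ := Nat.exists_eq_add_of_lt hb
  obtain ⟨c, rfl⟩ := Nat.exists_eq_add_of_lt hc
  have hd : (d : ℝ) = a + b + c + 5 := by
    have : d = a + b + c + 5 := by omega
    exact_mod_cast this
  rw [hd]
  push_cast
  have h1 : (0 : ℝ) ≤ a * b * c := by positivity
  have h2 : (0 : ℝ) ≤ a * b + b * c + a * c := by positivity
  have h3 : (0 : ℝ) ≤ a + b + c := by positivity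
  nlinarith

/-- The resistance of three consecutive tight layers. -/
lemma Layering.resistance_le (hL : Layering G l p H) (hreg : ∀ v, (G.neighborSet v).ncard = d)
    (hd : Even d) (hd4 : 4 ≤ d) {i : ℕ} (h1 : Tight l H d i) (h2 : Tight l H d (i + 1))
    (h3 : Tight l H d (i + 2)) (h4 : Tight l H d (i + 3)) :
    1 / (#(rep l p H d i) * #(rep l p H d (i + 1)) : ℝ) +
      1 / (#(rep l p H d (i + 1)) * #(rep l p H d (i + 2)) : ℝ) +
      1 / (#(rep l p H d (i + 2)) * #(rep l p H d (i + 3)) : ℝ) ≤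
      ((d : ℝ) + 1) / (2 * ((d : ℝ) - 2)) := by
  rw [rep_of_tight h1, rep_of_tight h2, rep_of_tight h3, rep_of_tight h4]
  have e2 := h2.2.2
  have e3 := h3.2.2
  rw [card_window (by omega)] at e2 e3
  simp only [show i + 1 - 1 = i by omega, show i + 1 + 1 = i + 2 by omega,
    show i + 2 - 1 = i + 1 by omega, show i + 2 + 1 = i + 3 by omega] at e2 e3
  have e4 : #(layer l (i + 3)) = #(layer l i) := by omega
  rw [e4]
  have p1 := hL.card_layer_pos h1.1 h1.2.1
  have p2 := hL.card_layer_pos h2.1 h2.2.1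
  have p3 := hL.card_layer_pos h3.1 h3.2.1
  have n1 := hL.card_mul_card_ne_one hreg hd h1.1 h2.2.1
  have n2 := hL.card_mul_card_ne_one hreg hd h2.1 h3.2.1
  have n3 := hL.card_mul_card_ne_one hreg hd h3.1 h4.2.1
  rw [show i + 2 + 1 = i + 3 by omega, e4] at n3
  have hmul := two_mul_sub_two_le_mul_mul p1 p2 p3 e2 n1 n2 n3
  have hsum : ((#(layer l i) : ℝ) + #(layer l (i + 1)) + #(layer l (i + 2))) = d + 1 := by
    exact_mod_cast e2
  generalize #(layer l i) = a at *
  generalize #(layer l (i + 1)) = b at *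
  generalize #(layer l (i + 2)) = c at *
  have q1 : (0 : ℝ) < a := by exact_mod_cast p1
  have q2 : (0 : ℝ) < b := by exact_mod_cast p2
  have q3 : (0 : ℝ) < c := by exact_mod_cast p3
  have hd' : (4 : ℝ) ≤ d := by exact_mod_cast hd4
  have : 1 / (a * b : ℝ) + 1 / (b * c : ℝ) + 1 / (c * a : ℝ) = (d + 1) / (a * b * c : ℝ) := by
    rw [← hsum]
    field_simp
    ring
  rw [this]
  exact div_le_div_of_nonneg_left (by positivity) (by linarith) hmul

lemma sum_card_layer_mul {B : ℕ} (hB : ∀ v, l v < B) (f : ℕ → ℝ) :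
    ∑ i ∈ range B, (#(layer l i) : ℝ) * f i = ∑ v, f (l v) := by
  rw [← sum_fiberwise_of_maps_to (s := univ) (t := range B) (g := l)
    (fun v _ => mem_range.2 (hB v))]
  refine sum_congr rfl fun i _ => ?_
  rw [sum_congr rfl (g := fun _ => f i) (fun v hv => by rw [(mem_filter.1 hv).2]), sum_const,
    nsmul_eq_mul]
  rfl

open scoped Classical in
/-- A finset containing every index `k` for which one of the layers `3 k - 2, …, 3 k + 2` is not
tight. -/
lemma Layering.exists_exceptional (hL : Layering G l p H)
    (hreg : ∀ v, (G.neighborSet v).ncard = d) {K : ℕ}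
    (hK : 3 * Fintype.card V ≤ H * (d + 1) + K) :
    ∃ bad : Finset ℕ, #bad ≤ 2 * (K + 3) ∧ 0 ∈ bad ∧ ∀ k ≤ H / 3, k ∉ bad → ∀ j,
      3 * k ≤ j + 2 → j ≤ 3 * k + 2 → Tight l H d j := by
  set nt : Finset ℕ := {i ∈ Icc 1 H | ¬ Tight l H d i} ∪ {0, H + 1, H + 2} with hnt
  have hmem : ∀ j ≤ H + 2, ¬ Tight l H d j → j ∈ nt := by
    intro j hj ht
    simp only [hnt, mem_union, mem_filter, mem_Icc, mem_insert, mem_singleton, ht]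
    simp only [not_false_eq_true, and_true]
    omega
  have hcard : #nt ≤ K + 3 :=
    (card_union_le _ _).trans (Nat.add_le_add (hL.card_not_tight_le hreg hK) card_le_three)
  refine ⟨nt.image (· / 3) ∪ nt.image (fun j => (j + 2) / 3), ?_, ?_, ?_⟩
  · have := card_union_le (nt.image (· / 3)) (nt.image (fun j => (j + 2) / 3))
    have := card_image_le (s := nt) (f := (· / 3))
    have := card_image_le (s := nt) (f := fun j => (j + 2) / 3)
    omega
  · refine mem_union_left _ (mem_image.2 ⟨0, by simp [hnt], rfl⟩)
  · intro k hk hkb j h1 h2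
    by_contra ht
    have hj := hmem j (by omega) ht
    refine hkb ?_
    by_cases h : 3 * k ≤ j
    · exact mem_union_left _ (mem_image.2 ⟨j, hj, by omega⟩)
    · exact mem_union_right _ (mem_image.2 ⟨j, hj, by omega⟩)

/-- The Poincaré constant of the path underlying a layering. -/
noncomputable def pathConstant (d K : ℕ) (δ N : ℝ) : ℝ :=
  (1 + δ) * (((d : ℝ) + 1) / (2 * ((d : ℝ) - 2)) * ((d : ℝ) + 1) /
    (2 - 2 * Real.cos (Real.pi * ((d : ℝ) + 1) / N)) + 3 * (2 * ((K : ℝ) + 3)) * N)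
    + (1 + 1 / δ) * (3 * ((d : ℝ) + 1 + K))

lemma Layering.path_poincare (hL : Layering G l p H) (hreg : ∀ v, (G.neighborSet v).ncard = d)
    (hd : Even d) (hd4 : 4 ≤ d) {K : ℕ} (hK : 3 * Fintype.card V ≤ H * (d + 1) + K) {δ : ℝ}
    (hδ : 0 < δ) (hcos : Real.cos (Real.pi * ((d : ℝ) + 1) / Fintype.card V) < 1)
    (x : V → ℝ) (a : ℝ) (ha : ∑ v, (meanOn x (rep l p H d (l v)) - a) = 0) :
    ∑ v, (meanOn x (rep l p H d (l v)) - a) ^ 2 ≤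
      pathConstant d K δ (Fintype.card V) * lapQ G x := by
  have hd' : (4 : ℝ) ≤ d := by exact_mod_cast hd4
  have hQ := lapQ_nonneg G x
  obtain ⟨bad, hbad, hbad0, hbadt⟩ := hL.exists_exceptional hreg hK
  set b := H / 3 with hb
  have hlt : ∀ v, l v < 3 * (b + 1) := fun v => by have := hL.le_top v; omega
  have hτ : 0 ≤ ((d : ℝ) + 1) / (2 * ((d : ℝ) - 2)) :=
    div_nonneg (by linarith) (by linarith)
  set m : ℕ → ℝ := fun i => #(layer l i) with hm
  set y : ℕ → ℝ := fun i => meanOn x (rep l p H d i) - a with hy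
  set A : ℕ → ℝ := fun i => #(rep l p H d i) with hA
  set c : ℕ → ℝ := fun i => A i * A (i + 1) with hc
  set r : ℕ → ℝ := fun i => 1 / (A (i - 1) * A i) with hr
  have hm0 : ∀ i, 0 ≤ m i := fun i => Nat.cast_nonneg _
  have hA0 : ∀ i, 0 ≤ A i := fun i => Nat.cast_nonneg _
  have hr0 : ∀ i, 0 ≤ r i := fun i =>
    one_div_nonneg.2 (mul_nonneg (hA0 _) (hA0 _))
  have hr1 : ∀ i, r i ≤ 1 := by
    intro i
    simp only [hr, hA, ← Nat.cast_mul]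
    rcases Nat.eq_zero_or_pos (#(rep l p H d (i - 1)) * #(rep l p H d i)) with h | h
    · simp [h]
    · have : (1 : ℝ) ≤ ((#(rep l p H d (i - 1)) * #(rep l p H d i) : ℕ) : ℝ) := by
        exact_mod_cast h
      rw [div_le_one (by linarith)]
      exact this
  have hsum : ∑ i ∈ range (3 * (b + 1)), m i * y i = 0 := by
    rw [sum_card_layer_mul hlt]
    exact ha
  have hN : ∑ i ∈ range (3 * (b + 1)), m i = Fintype.card V := by
    have := sum_card_layer_mul hlt (fun _ => 1)
    simpa using this
  have hE : ∑ i ∈ range (3 * (b + 1)), m i * y i ^ 2 =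
      ∑ v, (meanOn x (rep l p H d (l v)) - a) ^ 2 :=
    sum_card_layer_mul hlt (fun i => y i ^ 2)
  have hempty : ∀ i, H < i → m i = 0 := by
    intro i hi
    simp only [hm, Nat.cast_eq_zero, card_eq_zero]
    ext v
    have := hL.le_top v
    simp only [mem_layer, notMem_empty, iff_false]
    omega
  have hempty0 : m 0 = 0 := by
    simp only [hm, Nat.cast_eq_zero, card_eq_zero]
    ext v
    have := hL.one_le v
    simp only [mem_layer, notMem_empty, iff_false]
    omega
  have hwin : ∀ k, m (3 * k) + m (3 * k + 1) + m (3 * k + 2) = #(window l (3 * k + 1)) := by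
    intro k
    rw [card_window (by omega)]
    push_cast
    rfl
  have hpos : ∀ i, 1 ≤ i → i ≤ H → 0 < m i := fun i h1 h2 =>
    Nat.cast_pos.2 (hL.card_layer_pos h1 h2)
  have hv : Nonempty V := by
    by_contra hne
    rw [not_nonempty_iff] at hne
    simp [Fintype.card_eq_zero] at hcos
  obtain ⟨v₀⟩ := hv
  have hH : 1 ≤ H := (hL.one_le v₀).trans (hL.le_top v₀)
  have hM : ∀ k ≤ b, 0 < m (3 * k) + m (3 * k + 1) + m (3 * k + 2) := by
    intro k hk
    have i0 := hm0 (3 * k)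
    have i1 := hm0 (3 * k + 1)
    have i2 := hm0 (3 * k + 2)
    rcases Nat.eq_zero_or_pos k with rfl | hk0
    · have := hpos (3 * 0 + 1) (by omega) (by omega)
      linarith
    · have := hpos (3 * k) (by omega) (by omega)
      linarith
  have hMC : ∀ k ≤ b, m (3 * k) + m (3 * k + 1) + m (3 * k + 2) ≤ (d : ℝ) + 1 + K := by
    intro k hk
    by_cases h : 3 * k + 1 ≤ H
    · rw [hwin]
      exact_mod_cast hL.card_window_le hreg hK (by omega) h
    · rw [hempty (3 * k + 1) (by omega), hempty (3 * k + 2) (by omega)]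
      have h1 := hL.card_window_le hreg hK (i := 3 * k) (by omega) (by omega)
      have h2 := (card_layer_le_card_window (l := l) (3 * k)).trans h1
      have h3 : m (3 * k) ≤ ((d + 1 + K : ℕ) : ℝ) := Nat.cast_le.2 h2
      push_cast at h3
      linarith
  have hflow := flow_energy_bound b m y r bad (d + 1) (Fintype.card V) (d + 1 + K)
    (((d : ℝ) + 1) / (2 * ((d : ℝ) - 2))) δ hm0 hr0 hr1 hδ (by positivity) hτ hM hMC hN hsum hcos
    (by
      intro k hk hkb
      have t1 := (hbadt (k + 1) (by omega) hkb (3 * k + 1) (by omega) (by omega)).2.2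
      have t2 := (hbadt (k + 1) (by omega) hkb (3 * (k + 1) + 1) (by omega) (by omega)).2.2
      rw [hwin, hwin, t1, t2]
      push_cast
      exact ⟨rfl, rfl⟩)
    (by
      intro k hk
      obtain ⟨hk, hkb⟩ := mem_sdiff.1 hk
      have hk := mem_range.1 hk
      obtain ⟨j, rfl⟩ : ∃ j, k = j + 1 :=
        ⟨k - 1, by have : k ≠ 0 := (by rintro rfl; exact hkb hbad0); omega⟩
      have t := hbadt (j + 1) (by omega) hkb
      exact hL.resistance_le hreg hd hd4 (i := 3 * j + 2) (t _ (by omega) (by omega))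
        (t _ (by omega) (by omega)) (t _ (by omega) (by omega)) (t _ (by omega) (by omega)))
  have hE0 : 0 ≤ ∑ i ∈ range (3 * (b + 1)), m i * y i ^ 2 :=
    sum_nonneg fun i _ => mul_nonneg (hm0 i) (sq_nonneg _)
  have hcos' : 0 < 2 - 2 * Real.cos (Real.pi * ((d : ℝ) + 1) / Fintype.card V) := by linarith
  have hΛ : 0 ≤ pathConstant d K δ (Fintype.card V) := by
    unfold pathConstant
    positivity
  rw [← hE]
  have hLb : 3 * (b + 1) = 3 * b + 2 + 1 := by ring
  have hflow' : ∑ i ∈ range (3 * (b + 1)), r i * (∑ j ∈ range i, m j * y j) ^ 2 ≤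
      pathConstant d K δ (Fintype.card V) * ∑ i ∈ range (3 * (b + 1)), m i * y i ^ 2 := by
    refine hflow.trans (mul_le_mul_of_nonneg_right ?_ hE0)
    have hbad' : (#bad : ℝ) ≤ 2 * ((K : ℝ) + 3) := by exact_mod_cast hbad
    unfold pathConstant
    gcongr
  rw [hLb] at hflow' hsum ⊢
  refine poincare_of_flow_bound m y c r _ _ _ hm0 hΛ hQ hr0
    (fun i => mul_nonneg (hA0 _) (hA0 _)) hsum ?_ ?_ hflow'
  · intro i hi
    by_cases h1 : 1 ≤ i
    · by_cases h2 : i + 1 ≤ H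
      · right
        have q1 : 0 < A i := Nat.cast_pos.2 (hL.rep_nonempty h1 (by omega)).card_pos
        have q2 : 0 < A (i + 1) := Nat.cast_pos.2 (hL.rep_nonempty (by omega) h2).card_pos
        simp only [hc, hr, Nat.add_sub_cancel]
        field_simp
      · left
        rw [← hsum]
        refine sum_subset (range_mono (by omega)) fun j _ hj => ?_
        rw [hempty j (by have := mem_range.not.1 hj; omega), zero_mul]
    · left
      obtain rfl : i = 0 := by omega
      simp [hempty0]
  · have h := hL.sum_energy_le hreg x (3 * b + 2)
    simpa only [hc, hA, hy, sub_sub_sub_cancel_right] using h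

/-- The constant in the Poincaré inequality for graphs with few layers that are not tight. -/
noncomputable def graphConstant (d K : ℕ) (δ N : ℝ) : ℝ :=
  (1 + δ) * pathConstant d K δ N + (1 + 1 / δ) * ((1 + ((d : ℝ) + 1 + K) * K * N) * 2)

lemma Layering.poincare (hL : Layering G l p H) (hG : G.Connected)
    (hreg : ∀ v, (G.neighborSet v).ncard = d)
    (hd : Even d) (hd4 : 4 ≤ d) {K : ℕ} (hK : 3 * Fintype.card V ≤ H * (d + 1) + K) {δ : ℝ}
    (hδ : 0 < δ) (hcos : Real.cos (Real.pi * ((d : ℝ) + 1) / Fintype.card V) < 1)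
    (x : V → ℝ) (hx : ∑ v, x v = 0) :
    ∑ v, x v ^ 2 ≤ graphConstant d K δ (Fintype.card V) * lapQ G x := by
  have := hG.nonempty
  have hN : (0 : ℝ) < Fintype.card V := by exact_mod_cast Fintype.card_pos
  set Y : V → ℝ := fun v => meanOn x (rep l p H d (l v)) with hY
  set a : ℝ := (∑ v, Y v) / Fintype.card V with ha
  have hYa : ∑ v, (Y v - a) = 0 := by
    rw [sum_sub_distrib, sum_const, nsmul_eq_mul, card_univ, ha]
    field_simp
    ring
  have h1 := hL.path_poincare hreg hd hd4 hK hδ hcos x a hYa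
  have h2 := hL.sum_sq_sub_meanOn_rep_le hG hreg hK x
  have h3 : ∑ v, x v ^ 2 ≤ ∑ v, (x v - a) ^ 2 := by
    have : ∑ v, (x v - a) ^ 2 = ∑ v, x v ^ 2 - 2 * a * ∑ v, x v + Fintype.card V * a ^ 2 := by
      simp only [sub_sq, sum_add_distrib, sum_sub_distrib, sum_const, nsmul_eq_mul, card_univ,
        mul_sum]
      congr 2
      exact sum_congr rfl fun v _ => by ring
    rw [this, hx]
    have : 0 ≤ (Fintype.card V : ℝ) * a ^ 2 := by positivity
    linarith
  have h4 : ∑ v, (x v - a) ^ 2 ≤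
      (1 + δ) * ∑ v, (Y v - a) ^ 2 + (1 + 1 / δ) * ∑ v, (x v - Y v) ^ 2 := by
    rw [mul_sum, mul_sum, ← sum_add_distrib]
    refine sum_le_sum fun v _ => ?_
    have := add_sq_le_weighted hδ (Y v - a) (x v - Y v)
    rwa [show Y v - a + (x v - Y v) = x v - a by ring] at this
  have h5 := mul_le_mul_of_nonneg_left h1 (show 0 ≤ 1 + δ by positivity)
  have h6 := mul_le_mul_of_nonneg_left h2 (show 0 ≤ 1 + 1 / δ by positivity)
  unfold graphConstant
  linarith

end Layers

lemma tendsto_sq_mul_two_sub_two_mul_cos (t : ℝ) :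
    Tendsto (fun n : ℕ => (n : ℝ) ^ 2 * (2 - 2 * Real.cos (t / n))) atTop (nhds (t ^ 2)) := by
  have h1 : Tendsto (fun n : ℕ => t / (n : ℝ) / 2) atTop (nhds 0) := by
    simpa using (tendsto_const_div_atTop_nhds_zero_nat t).div_const 2
  have h2 : Tendsto (fun n : ℕ => t ^ 2 * Real.sinc (t / (n : ℝ) / 2) ^ 2) atTop
      (nhds (t ^ 2 * Real.sinc 0 ^ 2)) :=
    (((Real.continuous_sinc.tendsto 0).comp h1).pow 2).const_mul _
  rw [Real.sinc_zero, one_pow, mul_one] at h2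
  refine h2.congr' ?_
  filter_upwards [eventually_gt_atTop 0] with n hn
  have hn' : (n : ℝ) ≠ 0 := by exact_mod_cast hn.ne'
  rcases eq_or_ne t 0 with rfl | ht
  · simp
  have hs : t / (n : ℝ) / 2 ≠ 0 := by positivity
  rw [Real.sinc_of_ne_zero hs, show t / (n : ℝ) = 2 * (t / n / 2) by ring, Real.cos_two_mul,
    Real.cos_sq']
  field_simp
  ring

lemma tendsto_graphConstant_div_sq (d K : ℕ) (hd : 4 ≤ d) (δ : ℝ) :
    Tendsto (fun n : ℕ => graphConstant d K δ n / (n : ℝ) ^ 2) atTop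
      (nhds ((1 + δ) ^ 2 / (2 * ((d : ℝ) - 2) * Real.pi ^ 2))) := by
  have hd' : (4 : ℝ) ≤ d := by exact_mod_cast hd
  have hpi := Real.pi_pos
  have hq : Real.pi * ((d : ℝ) + 1) ≠ 0 := by positivity
  have hd2 : (d : ℝ) - 2 ≠ 0 := by linarith
  have hinv : Tendsto (fun n : ℕ => ((n : ℝ))⁻¹) atTop (nhds 0) := tendsto_inv_atTop_nhds_zero_nat
  have hinv2 : Tendsto (fun n : ℕ => ((n : ℝ))⁻¹ ^ 2) atTop (nhds 0) := by
    simpa using hinv.pow 2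
  have hcos := (tendsto_sq_mul_two_sub_two_mul_cos (Real.pi * ((d : ℝ) + 1))).inv₀ (pow_ne_zero 2 hq)
  have h := ((((hcos.const_mul (((d : ℝ) + 1) / (2 * ((d : ℝ) - 2)) * ((d : ℝ) + 1))).add
      (hinv.const_mul (3 * (2 * ((K : ℝ) + 3))))).const_mul (1 + δ)).add
      (hinv2.const_mul ((1 + 1 / δ) * (3 * ((d : ℝ) + 1 + K))))).const_mul (1 + δ) |>.add
      (((hinv2.add (hinv.const_mul (((d : ℝ) + 1 + K) * K))).mul_const 2).const_mul (1 + 1 / δ))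
  convert h.congr' ?_ using 2
  · field_simp
    ring
  · filter_upwards [eventually_gt_atTop 0] with n hn
    have hn' : (n : ℝ) ≠ 0 := by exact_mod_cast hn.ne'
    unfold graphConstant pathConstant
    rw [mul_inv]
    generalize 2 - 2 * Real.cos (Real.pi * ((d : ℝ) + 1) / n) = z
    rw [div_eq_mul_inv _ z]
    field_simp

lemma exists_forall_graphConstant_mul_le (d K : ℕ) (hd : 4 ≤ d) {ε : ℝ} (hε : 0 < ε)
    (hε1 : ε < 1) : ∃ N : ℕ, ∀ n : ℕ, N ≤ n →
      2 ≤ n ∧ Real.cos (Real.pi * ((d : ℝ) + 1) / n) < 1 ∧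
      graphConstant d K (ε / 8) n * ((1 - ε) * (2 * ((d : ℝ) - 2)) * Real.pi ^ 2) ≤
        (n : ℝ) ^ 2 := by
  have hd' : (4 : ℝ) ≤ d := by exact_mod_cast hd
  have hd2 : 0 < (d : ℝ) - 2 := by linarith
  have hpi := Real.pi_pos
  have h1 := (tendsto_graphConstant_div_sq d K hd (ε / 8)).mul_const
    ((1 - ε) * (2 * ((d : ℝ) - 2)) * Real.pi ^ 2)
  have hlim : (1 + ε / 8) ^ 2 / (2 * ((d : ℝ) - 2) * Real.pi ^ 2) *
      ((1 - ε) * (2 * ((d : ℝ) - 2)) * Real.pi ^ 2) = (1 + ε / 8) ^ 2 * (1 - ε) := by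
    field_simp
  rw [hlim] at h1
  have hlt : (1 + ε / 8) ^ 2 * (1 - ε) < 1 := by
    have h : (1 + ε / 8) ^ 2 ≤ 1 + ε := by nlinarith
    nlinarith [mul_le_mul_of_nonneg_right h (show 0 ≤ 1 - ε by linarith), pow_pos hε 2]
  have h2 := h1.eventually_lt_const hlt
  have h3 := (tendsto_sq_mul_two_sub_two_mul_cos (Real.pi * ((d : ℝ) + 1))).eventually_const_lt
    (u := 0) (by positivity)
  obtain ⟨N, hN⟩ := eventually_atTop.1 (h2.and (h3.and (eventually_ge_atTop 2)))
  refine ⟨N, fun n hn => ?_⟩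
  obtain ⟨a1, a2, a3⟩ := hN n hn
  have hn' : (0 : ℝ) < n := by exact_mod_cast (by omega : 0 < n)
  refine ⟨a3, ?_, ?_⟩
  · have := pos_of_mul_pos_right a2 (by positivity)
    linarith
  · rw [div_mul_eq_mul_div, div_lt_one (by positivity)] at a1
    exact a1.le

/-- for every even `d ≥ 4` and all `c ≥ 0`, `ε > 0` there is `N` such that
every connected `d`-regular graph on `n ≥ N` vertices with `diam(G) ≥ 3n/(d+1) − c`
satisfies `μ(G) ≥ (1−ε)·2(d−2)·π²/n²`. -/
theorem statement17 (d : ℕ) (hd : 4 ≤ d) (hdeven : Even d)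
    (c : ℝ) (hc : 0 ≤ c) (ε : ℝ) (hε : 0 < ε) :
    ∃ N : ℕ, ∀ n : ℕ, N ≤ n → ∀ G : SimpleGraph (Fin n), G.Connected →
      (∀ v, (G.neighborSet v).ncard = d) →
      3 * (n : ℝ) / ((d : ℝ) + 1) - c ≤ (G.diam : ℝ) →
      (1 - ε) * (2 * ((d : ℝ) - 2)) * Real.pi ^ 2 / (n : ℝ) ^ 2 ≤ algConn G := by
  have hd' : (4 : ℝ) ≤ d := by exact_mod_cast hd
  have hd2 : 0 < (d : ℝ) - 2 := by linarith
  rcases le_or_gt 1 ε with hε1 | hε1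
  · refine ⟨0, fun n _ G _ _ _ => le_trans (b := 0) ?_ (Real.sInf_nonneg ?_)⟩
    · refine div_nonpos_of_nonpos_of_nonneg ?_ (by positivity)
      rw [mul_assoc]
      exact mul_nonpos_of_nonpos_of_nonneg (by linarith) (by positivity)
    · rintro _ ⟨x, -, -, rfl⟩
      exact div_nonneg (lapQ_nonneg G x) (sum_nonneg fun v _ => sq_nonneg _)
  set K := ⌈c * ((d : ℝ) + 1)⌉₊
  obtain ⟨N, hN⟩ := exists_forall_graphConstant_mul_le d K hd hε hε1
  refine ⟨N, fun n hn G hG hreg hdiam => ?_⟩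
  obtain ⟨hn2, hcos, hconst⟩ := hN n hn
  have hn0 : (0 : ℝ) < n := by exact_mod_cast (by omega : 0 < n)
  obtain ⟨l, p, hL⟩ := exists_layering hG
  have hK : 3 * Fintype.card (Fin n) ≤ (G.diam + 1) * (d + 1) + K := by
    rw [Fintype.card_fin]
    have h1 : c * ((d : ℝ) + 1) ≤ K := Nat.le_ceil _
    have h2 : 3 * (n : ℝ) ≤ (G.diam + c) * ((d : ℝ) + 1) :=
      (div_le_iff₀ (by positivity)).1 (by linarith)
    have h3 : 3 * (n : ℝ) ≤ (G.diam + 1) * ((d : ℝ) + 1) + K := by nlinarith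
    exact_mod_cast h3
  refine le_csInf ?_ ?_
  · refine ⟨_, Pi.single ⟨0, by omega⟩ 1 - Pi.single ⟨1, by omega⟩ 1, ?_, ?_, rfl⟩
    · intro h
      have := congrFun h ⟨0, by omega⟩
      simp at this
    · simp [sum_sub_distrib]
  · rintro _ ⟨x, hx0, hx, rfl⟩
    have hpos : 0 < ∑ v, x v ^ 2 := by
      obtain ⟨v, hv⟩ := Function.ne_iff.1 hx0
      exact sum_pos' (fun w _ => sq_nonneg _) ⟨v, mem_univ v, by
        have : x v ≠ 0 := hv
        positivity⟩
    have h := hL.poincare hG hreg hdeven hd hK (δ := ε / 8) (by positivity)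
      (by rwa [Fintype.card_fin]) x hx
    rw [Fintype.card_fin] at h
    rw [div_le_div_iff₀ (by positivity) hpos]
    have hB : 0 ≤ (1 - ε) * (2 * ((d : ℝ) - 2)) * Real.pi ^ 2 := by
      have : 0 ≤ 1 - ε := by linarith
      positivity
    have h1 := mul_le_mul_of_nonneg_left h hB
    have h2 := mul_le_mul_of_nonneg_right hconst (lapQ_nonneg G x)
    linarith
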